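/- Let M be a (2n+s)-dimensional trans-S-manifold with characteristic functions α_i, β_i, fundamental 2-form F and codifferential δ. Then (δF)(ξ_i) = 2n α_i and δη_i = −2n β_i, for every i = 1, …, s. -/

import Mathlib

open scoped BigOperators

noncomputable section

/-- An abstract model of the algebra of smooth real-valued functions `C` of a
manifold together with its Lie algebra `V` of smooth vector fields: each vector
field acts on functions as a derivation, compatibly with the module structure
and the Lie bracket. -/
structure DiffModel (C V : Type) [CommRing C] [Algebra ℝ C]
    [LieRing V] [Module C V] where
  act : V → C → C
  act_add_left : ∀ (X Y : V) (a : C), act (X + Y) a = act X a + act Y a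
  act_smul_left : ∀ (c : C) (X : V) (a : C), act (c • X) a = c * act X a
  act_add : ∀ (X : V) (a b : C), act X (a + b) = act X a + act X b
  act_mul : ∀ (X : V) (a b : C), act X (a * b) = act X a * b + a * act X b
  act_const : ∀ (X : V) (r : ℝ), act X ((algebraMap ℝ C) r) = 0
  act_bracket : ∀ (X Y : V) (a : C),
    act ⁅X, Y⁆ a = act X (act Y a) - act Y (act X a)
  bracket_smul_right : ∀ (X : V) (c : C) (Y : V),
    ⁅X, c • Y⁆ = act X c • Y + c • ⁅X, Y⁆

/-- A Riemannian metric together with its Levi-Civita connection on the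
abstract model `D` of the vector fields of a manifold. -/
structure RiemStr {C V : Type} [CommRing C] [Algebra ℝ C]
    [LieRing V] [Module C V] (D : DiffModel C V) where
  g : V → V → C
  conn : V → V → V
  g_symm : ∀ X Y, g X Y = g Y X
  g_add_left : ∀ X Y Z, g (X + Y) Z = g X Z + g Y Z
  g_smul_left : ∀ (c : C) (X Y : V), g (c • X) Y = c * g X Y
  conn_add_left : ∀ X Y Z, conn (X + Y) Z = conn X Z + conn Y Z
  conn_smul_left : ∀ (c : C) (X Y : V), conn (c • X) Y = c • conn X Y
  conn_add_right : ∀ X Y Z, conn X (Y + Z) = conn X Y + conn X Z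
  conn_smul_right : ∀ (X : V) (c : C) (Y : V),
    conn X (c • Y) = D.act X c • Y + c • conn X Y
  torsion_free : ∀ X Y, conn X Y - conn Y X = ⁅X, Y⁆
  metric_compat : ∀ X Y Z, D.act X (g Y Z) = g (conn X Y) Z + g Y (conn X Z)

/-- An `f`-structure with `s` structure vector fields `ξ i` and dual `1`-forms
`η i` on the abstract model of the vector fields of a manifold:
`f` is a `(1,1)`-tensor field with `f ∘ f ∘ f + f = 0`, `f (ξ i) = 0`,
`η i ∘ f = 0`, `η i (ξ j) = δ i j` and `f² = -id + Σ η i ⊗ ξ i`. -/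
structure FStr (C V : Type) [CommRing C] [Algebra ℝ C]
    [LieRing V] [Module C V] (s : ℕ) where
  f : V → V
  ξ : Fin s → V
  η : Fin s → V → C
  f_add : ∀ X Y, f (X + Y) = f X + f Y
  f_smul : ∀ (c : C) (X : V), f (c • X) = c • f X
  η_add : ∀ i X Y, η i (X + Y) = η i X + η i Y
  η_smul : ∀ i (c : C) (X : V), η i (c • X) = c * η i X
  f_cube : ∀ X, f (f (f X)) + f X = 0
  f_ξ : ∀ i, f (ξ i) = 0
  η_f : ∀ i X, η i (f X) = 0
  η_ξ : ∀ i j, η i (ξ j) = if i = j then (1 : C) else 0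
  f_sq : ∀ X, f (f X) = -X + ∑ i, η i X • ξ i

section Defs

variable {C V : Type} [CommRing C] [Algebra ℝ C] [LieRing V] [Module C V] {s : ℕ}

/-- The compatibility of the metric with the `f`-structure:
`g(X,Y) = g(fX,fY) + Σ η i (X) η i (Y)`.  A metric `f`-manifold is the data of
`D`, `R`, `S` satisfying `MetricCompat D R S`. -/
def MetricCompat (D : DiffModel C V) (R : RiemStr D) (S : FStr C V s) : Prop :=
  ∀ X Y, R.g X Y = R.g (S.f X) (S.f Y) + ∑ i, S.η i X * S.η i Y

/-- The covariant derivative `(∇_X f) Y` of the tensor field `f`. -/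
def nablaF (D : DiffModel C V) (R : RiemStr D) (S : FStr C V s) (X Y : V) : V :=
  R.conn X (S.f Y) - S.f (R.conn X Y)

/-- The Nijenhuis tensor `[f,f]` of `f`. -/
def nijenhuis (S : FStr C V s) (X Y : V) : V :=
  S.f (S.f ⁅X, Y⁆) + ⁅S.f X, S.f Y⁆ - S.f ⁅S.f X, Y⁆ - S.f ⁅X, S.f Y⁆

/-- The exterior differential of a `1`-form,
`dθ(X,Y) = ½ (X θ(Y) - Y θ(X) - θ([X,Y]))`. -/
def dOne (D : DiffModel C V) (θ : V → C) (X Y : V) : C :=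
  algebraMap ℝ C (1 / 2) * (D.act X (θ Y) - D.act Y (θ X) - θ ⁅X, Y⁆)

/-- The exterior differential of a `2`-form. -/
def dTwo (D : DiffModel C V) (ω : V → V → C) (X Y Z : V) : C :=
  D.act X (ω Y Z) - D.act Y (ω X Z) + D.act Z (ω X Y)
    - ω ⁅X, Y⁆ Z + ω ⁅X, Z⁆ Y - ω ⁅Y, Z⁆ X

/-- The fundamental `2`-form `F(X,Y) = g(X, fY)` of a metric `f`-manifold. -/
def Fform (D : DiffModel C V) (R : RiemStr D) (S : FStr C V s) (X Y : V) : C :=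
  R.g X (S.f Y)

/-- Normality of an `f`-structure: `[f,f] + 2 Σ dη i ⊗ ξ i = 0`. -/
def IsNormal (D : DiffModel C V) (S : FStr C V s) : Prop :=
  ∀ X Y, nijenhuis S X Y + (2 : C) • ∑ i, dOne D (S.η i) X Y • S.ξ i = 0

/-- The almost trans-`S` condition with characteristic functions `α i`, `β i`:
`(∇_X f)Y = Σ [α i {g(fX,fY) ξ i + η i (Y) f²X} + β i {g(fX,Y) ξ i − η i (Y) fX}]`. -/
def IsAlmostTransS (D : DiffModel C V) (R : RiemStr D) (S : FStr C V s)
    (α β : Fin s → C) : Prop :=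
  ∀ X Y, nablaF D R S X Y =
    ∑ i, (α i • (R.g (S.f X) (S.f Y) • S.ξ i + S.η i Y • S.f (S.f X))
        + β i • (R.g (S.f X) Y • S.ξ i - S.η i Y • S.f X))

/-- A trans-`S`-manifold is a normal almost trans-`S`-manifold. -/
def IsTransS (D : DiffModel C V) (R : RiemStr D) (S : FStr C V s)
    (α β : Fin s → C) : Prop :=
  IsAlmostTransS D R S α β ∧ IsNormal D S

/-- A `K`-manifold: normal with closed fundamental `2`-form. -/
def IsK (D : DiffModel C V) (R : RiemStr D) (S : FStr C V s) : Prop :=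
  IsNormal D S ∧ ∀ X Y Z, dTwo D (Fform D R S) X Y Z = 0

/-- An `S`-manifold: a `K`-manifold with `F = dη i` for every `i`. -/
def IsSman (D : DiffModel C V) (R : RiemStr D) (S : FStr C V s) : Prop :=
  IsK D R S ∧ ∀ i X Y, Fform D R S X Y = dOne D (S.η i) X Y

/-- A `C`-manifold: a `K`-manifold with `dη i = 0` for every `i`. -/
def IsCman (D : DiffModel C V) (R : RiemStr D) (S : FStr C V s) : Prop :=
  IsK D R S ∧ ∀ (i : Fin s) X Y, dOne D (S.η i) X Y = 0

/-- The covariant derivative `(∇_X ω)(Y,Z)` of a `2`-form. -/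
def covTwo (D : DiffModel C V) (R : RiemStr D) (ω : V → V → C) (X Y Z : V) : C :=
  D.act X (ω Y Z) - ω (R.conn X Y) Z - ω Y (R.conn X Z)

/-- The covariant derivative `(∇_X θ)(Y)` of a `1`-form. -/
def covOne (D : DiffModel C V) (R : RiemStr D) (θ : V → C) (X Y : V) : C :=
  D.act X (θ Y) - θ (R.conn X Y)

/-- A global `f`-basis `{X_1,…,X_n, fX_1,…,fX_n, ξ_1,…,ξ_s}` of a
`(2n+s)`-dimensional metric `f`-manifold. -/
structure FBasis (D : DiffModel C V) (R : RiemStr D) (S : FStr C V s)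
    (n : ℕ) where
  e : Fin n → V
  orth : ∀ k l, R.g (e k) (e l) = if k = l then (1 : C) else 0
  orth_f : ∀ k l, R.g (e k) (S.f (e l)) = 0
  horiz : ∀ i k, S.η i (e k) = 0
  span : ∀ X : V, X = ∑ k, R.g X (e k) • e k
      + ∑ k, R.g X (S.f (e k)) • S.f (e k) + ∑ i, S.η i X • S.ξ i

/-- The codifferential `δω` of a `2`-form, computed in an `f`-basis:
`(δω)(X) = -Σ_k [(∇_{X_k}ω)(X_k,X) + (∇_{fX_k}ω)(fX_k,X)] - Σ_j (∇_{ξ_j}ω)(ξ_j,X)`. -/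
def codiffTwo {n : ℕ} (D : DiffModel C V) (R : RiemStr D) (S : FStr C V s)
    (B : FBasis D R S n) (ω : V → V → C) (X : V) : C :=
  -(∑ k, (covTwo D R ω (B.e k) (B.e k) X
      + covTwo D R ω (S.f (B.e k)) (S.f (B.e k)) X))
    - ∑ j, covTwo D R ω (S.ξ j) (S.ξ j) X

/-- The codifferential `δθ` of a `1`-form, computed in an `f`-basis. -/
def codiffOne {n : ℕ} (D : DiffModel C V) (R : RiemStr D) (S : FStr C V s)
    (B : FBasis D R S n) (θ : V → C) : C :=
  -(∑ k, (covOne D R θ (B.e k) (B.e k)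
      + covOne D R θ (S.f (B.e k)) (S.f (B.e k))))
    - ∑ j, covOne D R θ (S.ξ j) (S.ξ j)

/-- The Lie derivative of the metric along `ξ`:
`(L_ξ g)(X,Y) = ξ g(X,Y) - g([ξ,X],Y) - g(X,[ξ,Y])`. -/
def lieDerivG (D : DiffModel C V) (R : RiemStr D) (ξ X Y : V) : C :=
  D.act ξ (R.g X Y) - R.g ⁅ξ, X⁆ Y - R.g X ⁅ξ, Y⁆

end Defs

section Helpers

variable {C V : Type} [CommRing C] [Algebra ℝ C] [LieRing V] [Module C V] {s n : ℕ}

lemma hp_f_zero (S : FStr C V s) : S.f 0 = 0 := by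
  have := S.f_smul 0 0
  simpa using this

lemma hp_f_neg (S : FStr C V s) (X : V) : S.f (-X) = -S.f X := by
  have := S.f_smul (-1) X
  simpa using this

lemma hp_eta_zero (S : FStr C V s) (i : Fin s) : S.η i 0 = 0 := by
  have := S.η_smul i 0 0
  simpa using this

lemma hp_eta_neg (S : FStr C V s) (i : Fin s) (X : V) : S.η i (-X) = -S.η i X := by
  have := S.η_smul i (-1) X
  simpa using this

lemma hp_eta_sum (S : FStr C V s) (i : Fin s) {ι : Type} (t : Finset ι) (v : ι → V) :
    S.η i (∑ k ∈ t, v k) = ∑ k ∈ t, S.η i (v k) := by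
  classical
  induction t using Finset.induction_on with
  | empty => simp [hp_eta_zero]
  | insert a t ha ih => rw [Finset.sum_insert ha, Finset.sum_insert ha, S.η_add, ih]

lemma hp_act_one {D : DiffModel C V} (X : V) : D.act X 1 = 0 := by
  have := D.act_const X 1
  simpa using this

lemma hp_act_zero {D : DiffModel C V} (X : V) : D.act X 0 = 0 := by
  have := D.act_const X 0
  simpa using this

variable {D : DiffModel C V} (R : RiemStr D)

lemma hp_g_zero_left (Y : V) : R.g 0 Y = 0 := by
  have := R.g_smul_left 0 0 Y
  simpa using this

lemma hp_g_neg_left (X Y : V) : R.g (-X) Y = -R.g X Y := by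
  have := R.g_smul_left (-1) X Y
  simpa using this

lemma hp_g_sub_left (X Y Z : V) : R.g (X - Y) Z = R.g X Z - R.g Y Z := by
  rw [sub_eq_add_neg, R.g_add_left, hp_g_neg_left, sub_eq_add_neg]

lemma hp_conn_zero (X : V) : R.conn X 0 = 0 := by
  have := R.conn_smul_right X 0 0
  simpa using this

variable {R} {S : FStr C V s}

lemma hp_g_xi (hc : MetricCompat D R S) (i : Fin s) (Y : V) :
    R.g (S.ξ i) Y = S.η i Y := by
  rw [hc, S.f_ξ, hp_g_zero_left]
  simp [S.η_ξ]

lemma hp_nabla_xi {α β : Fin s → C} (hc : MetricCompat D R S)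
    (h : IsAlmostTransS D R S α β) (X : V) (i : Fin s) :
    S.f (R.conn X (S.ξ i)) = β i • S.f X - α i • S.f (S.f X) := by
  have h1 := h X (S.ξ i)
  have h2 : R.g (S.f X) (S.ξ i) = 0 := by rw [R.g_symm, hp_g_xi hc, S.η_f]
  have h3 : R.g (S.f X) (S.f (S.ξ i)) = 0 := by rw [S.f_ξ, R.g_symm, hp_g_zero_left]
  rw [h2, h3, nablaF, S.f_ξ, hp_conn_zero] at h1
  simp only [S.η_ξ, zero_smul, zero_add, zero_sub, ite_smul, one_smul, smul_add, smul_neg,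
    smul_ite, smul_zero, Finset.sum_add_distrib, Finset.sum_neg_distrib, Finset.sum_ite_eq',
    Finset.mem_univ, if_true] at h1
  rw [← neg_inj, h1]
  abel

lemma hp_covTwo {α β : Fin s → C} (hc : MetricCompat D R S)
    (h : IsAlmostTransS D R S α β) (X : V) (i : Fin s) :
    covTwo D R (Fform D R S) X X (S.ξ i)
      = α i * R.g X (S.f (S.f X)) - β i * R.g X (S.f X) := by
  have z : ∀ Y, R.g Y 0 = 0 := fun Y => by rw [R.g_symm, hp_g_zero_left]
  simp only [covTwo, Fform, S.f_ξ, z, hp_act_zero, hp_nabla_xi hc h]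
  rw [R.g_symm X (_ - _), hp_g_sub_left, R.g_smul_left, R.g_smul_left,
    R.g_symm X, R.g_symm X]
  ring

lemma hp_covOne {α β : Fin s → C} (hc : MetricCompat D R S)
    (h : IsAlmostTransS D R S α β) (X : V) (i : Fin s) (hX : ∀ j, S.η j X = 0) :
    covOne D R (S.η i) X X
      = β i * R.g (S.f X) (S.f X) - α i * R.g (S.f (S.f X)) (S.f X) := by
  have h1 : covOne D R (S.η i) X X = R.g (R.conn X (S.ξ i)) X := by
    rw [covOne, ← hp_g_xi hc, ← hp_g_xi hc, R.metric_compat]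
    ring
  rw [h1, hc, hp_nabla_xi hc h, hp_g_sub_left, R.g_smul_left, R.g_smul_left]
  simp [hX]

lemma hp_two_half : (2 : C) * algebraMap ℝ C (1 / 2) = 1 := by
  have : (2 : C) = algebraMap ℝ C 2 := (map_ofNat (algebraMap ℝ C) 2).symm
  rw [this, ← map_mul]
  norm_num

lemma hp_act_eta {X : V} (i j : Fin s) : D.act X (S.η i (S.ξ j)) = 0 := by
  rw [S.η_ξ]
  split_ifs
  · exact hp_act_one X
  · exact hp_act_zero X

lemma hp_bracket (hN : IsNormal D S) (i j k : Fin s) : S.η k ⁅S.ξ i, S.ξ j⁆ = 0 := by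
  have h1 := congrArg (S.η k) (hN (S.ξ i) (S.ξ j))
  simp only [nijenhuis, S.f_ξ, zero_lie, lie_zero, hp_f_zero, sub_zero, add_zero,
    S.η_add, S.η_f, S.η_smul, hp_eta_sum, hp_eta_zero, S.η_ξ, mul_ite, mul_one, mul_zero,
    Finset.sum_ite_eq, Finset.mem_univ, if_true, zero_add, dOne] at h1
  rw [← mul_assoc, hp_two_half] at h1
  have e1 := hp_act_eta (D := D) (S := S) (X := S.ξ i) k j
  have e2 := hp_act_eta (D := D) (S := S) (X := S.ξ j) k i
  rw [S.η_ξ] at e1 e2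
  rw [e1, e2] at h1
  simpa using h1

lemma hp_covOne_xi (hc : MetricCompat D R S) (hN : IsNormal D S) (i j : Fin s) :
    covOne D R (S.η i) (S.ξ j) (S.ξ j) = 0 := by
  have h1 : covOne D R (S.η i) (S.ξ j) (S.ξ j) = R.g (R.conn (S.ξ j) (S.ξ i)) (S.ξ j) := by
    rw [covOne, ← hp_g_xi hc, ← hp_g_xi hc, R.metric_compat]
    ring
  have h2 : R.g (R.conn (S.ξ j) (S.ξ i)) (S.ξ j) = R.g (R.conn (S.ξ i) (S.ξ j)) (S.ξ j) := by
    have := hp_bracket hN j i j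
    rw [← R.torsion_free, ← hp_g_xi hc, R.g_symm, hp_g_sub_left] at this
    exact sub_eq_zero.mp this
  have h3 := R.metric_compat (S.ξ i) (S.ξ j) (S.ξ j)
  rw [hp_g_xi hc, hp_act_eta, R.g_symm (S.ξ j)] at h3
  rw [h1, h2]
  set x := R.g (R.conn (S.ξ i) (S.ξ j)) (S.ξ j)
  linear_combination (-x) * (hp_two_half (C := C)) - algebraMap ℝ C (1 / 2) * h3

lemma hp_ff (B : FBasis D R S n) (k : Fin n) : S.f (S.f (B.e k)) = -B.e k := by
  rw [S.f_sq]
  simp [B.horiz]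

end Helpers

/-- In a `(2n+s)`-dimensional trans-`S`-manifold,
`(δF)(ξ_i) = 2n α_i` and `δη_i = −2n β_i` for every `i`. -/
theorem transS_codifferentials
    {C V : Type} [CommRing C] [Algebra ℝ C] [LieRing V] [Module C V]
    {s n : ℕ} (D : DiffModel C V) (R : RiemStr D) (S : FStr C V s)
    (hcompat : MetricCompat D R S) (B : FBasis D R S n) (α β : Fin s → C)
    (hM : IsTransS D R S α β) :
    ∀ i : Fin s,
      codiffTwo D R S B (Fform D R S) (S.ξ i) = ((2 * n : ℕ) : C) * α i ∧
      codiffOne D R S B (S.η i) = -(((2 * n : ℕ) : C) * β i) := by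
  intro i
  obtain ⟨hA, hN⟩ := hM
  have ff := hp_ff B
  have g1 : ∀ k, R.g (B.e k) (B.e k) = 1 := fun k => by simp [B.orth]
  have g2 : ∀ k, R.g (S.f (B.e k)) (S.f (B.e k)) = 1 := fun k => by
    have := hcompat (B.e k) (B.e k)
    simp only [B.horiz, g1, mul_zero, Finset.sum_const_zero, add_zero] at this
    exact this.symm
  have g3 : ∀ k, R.g (S.f (B.e k)) (B.e k) = 0 := fun k => by rw [R.g_symm, B.orth_f]
  have nr : ∀ X Y, R.g X (-Y) = -R.g X Y := fun X Y => by
    rw [R.g_symm, hp_g_neg_left, R.g_symm]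
  have zr : ∀ X, R.g X 0 = 0 := fun X => by rw [R.g_symm, hp_g_zero_left]
  constructor
  · simp only [codiffTwo, hp_covTwo hcompat hA, ff, hp_f_neg, nr, g1, g2, g3, B.orth_f, S.f_ξ,
      hp_f_zero, zr]
    simp
    ring
  · have c1 : ∀ k, covOne D R (S.η i) (B.e k) (B.e k) = β i := fun k => by
      rw [hp_covOne hcompat hA _ _ (fun j => B.horiz j k), ff, hp_g_neg_left, g2, B.orth_f]
      ring
    have c2 : ∀ k, covOne D R (S.η i) (S.f (B.e k)) (S.f (B.e k)) = β i := fun k => by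
      rw [hp_covOne hcompat hA _ _ (fun j => S.η_f j _), ff, hp_f_neg, hp_g_neg_left,
        hp_g_neg_left, nr, nr, g1, g3]
      ring
    simp only [codiffOne, c1, c2, hp_covOne_xi hcompat hN]
    simp
    ring
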